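/- Equivalent characterizations of new dual EP matrices: with the Hartwig–Spindelböck decomposition data as in the context, assuming K is invertible, with Â^N := Û · fromBlocks(K*Σ₁⁻¹, 0, L*Σ₁⁻¹, 0) · Û* (the NDMPI of Â), A_e := Û · fromBlocks(Σ₁K, Σ₁L, 0, 0) · Û* (the essential part of Â), and A_e^# := Û · fromBlocks(K⁻¹Σ₁⁻¹, K⁻¹Σ₁⁻¹K⁻¹L, 0, 0) · Û* (the group inverse of A_e), the following are equivalent: (i) Â·Â^N = Â^N·Â; (ii) Â·Â^N·Â* = Â*·Â·Â^N; (iii) Â*·Â^N·Â = Â^N·Â·Â*; (iv) Â^N·Â^N = Â^N·A_e^#; (v) Â^N·Â^N = A_e^#·Â^N; (vi) Â^N·Â^N = A_e^#·A_e^#; (vii) A_e^#·Â^N = A_e^#·A_e^#; (viii) Â^N·A_e^# = A_e^#·A_e^#; (ix) Â^N·A_e^# = A_e^#·Â^N; (x) Â^N·Â^N·A_e^# = Â^N·A_e^#·Â^N; (xi) Â^N·Â^N·A_e^# = A_e^#·Â^N·Â^N; (xii) Â^N·A_e^#·Â^N = A_e^#·Â^N·Â^N; (xiii) Â^N·A_e^#·A_e^#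 = A_e^#·Â^N·A_e^#; (xiv) Â^N·A_e^#·A_e^# = A_e^#·A_e^#·Â^N; (xv) A_e^#·A_e^#·Â^N = A_e^#·Â^N·A_e^#. -/

import Mathlib

open Matrix

/-- The dual complex numbers `𝔻ℂ := ℂ[ε]`, the trivial square-zero extension of `ℂ` by `ℂ`. -/
abbrev DC := TrivSqZeroExt ℂ ℂ

/-- Star on dual complex numbers: `(a + b·ε)* = conj a + conj b · ε`. -/
instance : Star DC :=
  ⟨fun x => ((starRingEnd ℂ) x.fst, (starRingEnd ℂ) x.snd)⟩

/-- A positive appreciable real dual number: the standard part is a positive real and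
the dual part is real. -/
def PosAppreciable (x : DC) : Prop :=
  (∃ a : ℝ, 0 < a ∧ x.fst = (a : ℂ)) ∧ (∃ b : ℝ, x.snd = (b : ℂ))

/-- A nonnegative infinitesimal real dual number: the standard part is `0` and
the dual part is a nonnegative real. -/
def NonnegInfinitesimal (x : DC) : Prop :=
  x.fst = 0 ∧ ∃ b : ℝ, 0 ≤ b ∧ x.snd = (b : ℂ)

/-- The standard part of a dual complex matrix. -/
def stdPart {m n : Type*} (X : Matrix m n DC) : Matrix m n ℂ :=
  X.map TrivSqZeroExt.fst

/-- The dual part of a dual complex matrix. -/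
def dualPart {m n : Type*} (X : Matrix m n DC) : Matrix m n ℂ :=
  X.map TrivSqZeroExt.snd

/-- The star on dual complex numbers makes them a star ring. -/
instance : StarRing DC where
  star_involutive x := by
    ext
    · exact Complex.conj_conj x.fst
    · exact Complex.conj_conj x.snd
  star_mul x y := by
    ext
    · change (starRingEnd ℂ) (x * y).fst = (star y * star x).fst
      rw [TrivSqZeroExt.fst_mul, TrivSqZeroExt.fst_mul, map_mul, mul_comm]
      rfl
    · change (starRingEnd ℂ) (x * y).snd = (star y * star x).snd
      rw [TrivSqZeroExt.snd_mul, TrivSqZeroExt.snd_mul]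
      change _ = (starRingEnd ℂ) y.fst * (starRingEnd ℂ) x.snd
        + (starRingEnd ℂ) y.snd * (starRingEnd ℂ) x.fst
      simp only [smul_eq_mul, MulOpposite.smul_eq_mul_unop, MulOpposite.unop_op, map_add, map_mul]
      ring
  star_add x y := by
    ext
    · exact map_add (starRingEnd ℂ) x.fst y.fst
    · exact map_add (starRingEnd ℂ) x.snd y.snd

theorem PosAppreciable.isUnit {x : DC} (hx : PosAppreciable x) : IsUnit x := by
  obtain ⟨⟨a, ha, hxa⟩, -⟩ := hx
  rw [TrivSqZeroExt.isUnit_iff_isUnit_fst, hxa]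
  exact isUnit_iff_ne_zero.mpr (Complex.ofReal_ne_zero.mpr ha.ne')

namespace HartwigSpindelbock

section Unitary

variable {R : Type*} [Ring R] [StarRing R] {n : Type*} [Fintype n]
  {U : Matrix n n R}

theorem conjTranspose_unitary_conj (X : Matrix n n R) :
    (U * X * Uᴴ)ᴴ = U * Xᴴ * Uᴴ := by
  simp only [conjTranspose_mul, conjTranspose_conjTranspose, Matrix.mul_assoc]

variable [DecidableEq n]

theorem unitary_conj_mul (hU : Uᴴ * U = 1) (X Y : Matrix n n R) :
    U * X * Uᴴ * (U * Y * Uᴴ) = U * (X * Y) * Uᴴ := by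
  calc U * X * Uᴴ * (U * Y * Uᴴ) = U * X * (Uᴴ * U) * Y * Uᴴ := by simp only [Matrix.mul_assoc]
    _ = U * (X * Y) * Uᴴ := by rw [hU, Matrix.mul_one, Matrix.mul_assoc U]

theorem unitary_conj_inj (hU : Uᴴ * U = 1) {X Y : Matrix n n R} :
    U * X * Uᴴ = U * Y * Uᴴ ↔ X = Y := by
  refine ⟨fun h => ?_, fun h => by rw [h]⟩
  have cancel (Z : Matrix n n R) : Uᴴ * (U * Z * Uᴴ) * U = Z := by
    calc Uᴴ * (U * Z * Uᴴ) * U = Uᴴ * U * Z * (Uᴴ * U) := by simp only [Matrix.mul_assoc]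
      _ = Z := by rw [hU, Matrix.one_mul, Matrix.mul_one]
  rw [← cancel X, h, cancel]

end Unitary

section Blocks

variable {R : Type*} [CommRing R] {m : Type*} [Fintype m] [DecidableEq m]

theorem mul_eq_zero_iff_of_isUnit_left {l : Type*} {G : Matrix m m R} (hG : IsUnit G)
    {X : Matrix m l R} : G * X = 0 ↔ X = 0 := by
  refine ⟨fun h => ?_, fun h => by rw [h, Matrix.mul_zero]⟩
  rw [← Matrix.nonsing_inv_mul_cancel_left G X ((isUnit_iff_isUnit_det G).mp hG), h,
    Matrix.mul_zero]

theorem mul_eq_zero_iff_of_isUnit_right {l : Type*} {G : Matrix m m R} (hG : IsUnit G)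
    {X : Matrix l m R} : X * G = 0 ↔ X = 0 := by
  refine ⟨fun h => ?_, fun h => by rw [h, Matrix.zero_mul]⟩
  rw [← Matrix.mul_nonsing_inv_cancel_right G X ((isUnit_iff_isUnit_det G).mp hG), h,
    Matrix.zero_mul]

theorem isUnit_inv {G : Matrix m m R} (hG : IsUnit G) : IsUnit G⁻¹ :=
  isUnit_nonsing_inv_iff.mpr hG

variable [StarRing R] {n : Type*} [Fintype n] [DecidableEq n]
  {K S₁ : Matrix m m R} {L : Matrix m n R} {M : Matrix n m R} {N S₂ : Matrix n n R}

/-- In block form, each of the commutation relations between the decomposed matrix, its NDMPI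
and the group inverse of its essential part holds exactly when `L = 0`. -/
theorem block_tfae (hW₁ : fromBlocks K L M N * (fromBlocks K L M N)ᴴ = 1)
    (hW₂ : (fromBlocks K L M N)ᴴ * fromBlocks K L M N = 1)
    (hS₁ : IsUnit S₁) (hK : IsUnit K)
    {A AN Aeg : Matrix (m ⊕ n) (m ⊕ n) R}
    (hA : A = fromBlocks (S₁ * K) (S₁ * L) (S₂ * M) (S₂ * N))
    (hAN : AN = fromBlocks (Kᴴ * S₁⁻¹) 0 (Lᴴ * S₁⁻¹) 0)
    (hAeg : Aeg = fromBlocks (K⁻¹ * S₁⁻¹) (K⁻¹ * S₁⁻¹ * K⁻¹ * L) 0 0) :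
    [A * AN = AN * A,
     A * AN * Aᴴ = Aᴴ * A * AN,
     Aᴴ * AN * A = AN * A * Aᴴ,
     AN * AN = AN * Aeg,
     AN * AN = Aeg * AN,
     AN * AN = Aeg * Aeg,
     Aeg * AN = Aeg * Aeg,
     AN * Aeg = Aeg * Aeg,
     AN * Aeg = Aeg * AN,
     AN * AN * Aeg = AN * Aeg * AN,
     AN * AN * Aeg = Aeg * AN * AN,
     AN * Aeg * AN = Aeg * AN * AN,
     AN * Aeg * Aeg = Aeg * AN * Aeg,
     AN * Aeg * Aeg = Aeg * Aeg * AN,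
     Aeg * Aeg * AN = Aeg * AN * Aeg].TFAE := by
  have hKd := (isUnit_iff_isUnit_det K).mp hK
  have hSd := (isUnit_iff_isUnit_det S₁).mp hS₁
  have hW₁' := hW₁
  rw [fromBlocks_conjTranspose, fromBlocks_multiply, ← fromBlocks_one, fromBlocks_inj] at hW₁' hW₂
  obtain ⟨hKL, hKM, hMK, -⟩ := hW₁'
  obtain ⟨hKK, hKL', -, -⟩ := hW₂
  set G := K⁻¹ * S₁⁻¹ with hG
  set X := Kᴴ * S₁⁻¹ with hX
  set Y := Lᴴ * S₁⁻¹ with hY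
  set H := G * K⁻¹ * L with hH
  have uG : IsUnit G := (isUnit_inv hK).mul (isUnit_inv hS₁)
  have uX : IsUnit X := hK.star.mul (isUnit_inv hS₁)
  have hY0 : Y = 0 ↔ L = 0 := by
    rw [hY, mul_eq_zero_iff_of_isUnit_right (isUnit_inv hS₁), conjTranspose_eq_zero]
  have hH0 : H = 0 ↔ L = 0 := mul_eq_zero_iff_of_isUnit_left (uG.mul (isUnit_inv hK))
  have hGXHY : G * X + H * Y = G * G := by
    calc G * X + H * Y = G * (K⁻¹ * (K * Kᴴ + L * Lᴴ)) * S₁⁻¹ := by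
          rw [Matrix.mul_add, Matrix.nonsing_inv_mul_cancel_left K _ hKd]
          simp only [hX, hY, hH, Matrix.mul_add, Matrix.add_mul, Matrix.mul_assoc]
      _ = G * G := by rw [hKL, Matrix.mul_one, Matrix.mul_assoc]
  have hAAN : A * AN = fromBlocks 1 0 0 0 := by
    have h₁ : S₁ * K * X + S₁ * L * Y = 1 := by
      calc S₁ * K * X + S₁ * L * Y = S₁ * (K * Kᴴ + L * Lᴴ) * S₁⁻¹ := by
            simp only [hX, hY, Matrix.mul_add, Matrix.add_mul, Matrix.mul_assoc]
        _ = 1 := by rw [hKL, Matrix.mul_one, Matrix.mul_nonsing_inv _ hSd]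
    have h₂ : S₂ * M * X + S₂ * N * Y = 0 := by
      calc S₂ * M * X + S₂ * N * Y = S₂ * (M * Kᴴ + N * Lᴴ) * S₁⁻¹ := by
            simp only [hX, hY, Matrix.mul_add, Matrix.add_mul, Matrix.mul_assoc]
        _ = 0 := by rw [hMK, Matrix.mul_zero, Matrix.zero_mul]
    rw [hA, hAN, fromBlocks_multiply, h₁, h₂]
    simp
  have hANA : AN * A = fromBlocks (Kᴴ * K) (Kᴴ * L) (Lᴴ * K) (Lᴴ * L) := by
    rw [hA, hAN, fromBlocks_multiply]
    simp only [hX, hY, Matrix.mul_assoc, Matrix.nonsing_inv_mul_cancel_left S₁ _ hSd,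
      Matrix.zero_mul, add_zero]
  have hAH : Aᴴ = fromBlocks (Kᴴ * S₁ᴴ) (Mᴴ * S₂ᴴ) (Lᴴ * S₁ᴴ) (Nᴴ * S₂ᴴ) := by
    rw [hA, fromBlocks_conjTranspose]
    simp only [conjTranspose_mul]
  have hAHW : Aᴴ = (fromBlocks K L M N)ᴴ * fromBlocks S₁ᴴ 0 0 S₂ᴴ := by
    rw [hAH, fromBlocks_conjTranspose, fromBlocks_multiply]
    simp
  have hANAW : AN * A = (fromBlocks K L M N)ᴴ * fromBlocks 1 0 0 0 * fromBlocks K L M N := by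
    rw [hANA, fromBlocks_conjTranspose, fromBlocks_multiply, fromBlocks_multiply]
    simp
  have hM0 (hL : L = 0) : M = 0 := by
    subst hL
    rw [Matrix.zero_mul, add_zero] at hKM
    rwa [mul_eq_zero_iff_of_isUnit_left hK, conjTranspose_eq_zero] at hKM
  have hAN_eq (hL : L = 0) : AN = Aeg := by
    subst hL
    have : K⁻¹ = Kᴴ := Matrix.inv_eq_right_inv (by simpa using hKL)
    rw [hAN, hAeg, hY0.mpr rfl, hH0.mpr rfl, hX, hG, this]
  have hANA_one (hL : L = 0) : AN * A = fromBlocks 1 0 0 0 := by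
    subst hL
    have h := hKK
    rw [hM0 rfl, Matrix.mul_zero, add_zero] at h
    rw [hANA, h]
    simp
  have cX {Z : Matrix m n R} (h : X * Z = 0) : Z = 0 := (mul_eq_zero_iff_of_isUnit_left uX).mp h
  have cG {Z : Matrix m n R} (h : G * Z = 0) : Z = 0 := (mul_eq_zero_iff_of_isUnit_left uG).mp h
  have cX' {Z : Matrix n m R} (h : Z * X = 0) : Z = 0 := (mul_eq_zero_iff_of_isUnit_right uX).mp h
  have cG' {Z : Matrix n m R} (h : Z * G = 0) : Z = 0 := (mul_eq_zero_iff_of_isUnit_right uG).mp h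
  have hANAN : AN * AN = fromBlocks (X * X) 0 (Y * X) 0 := by
    simp [hAN, fromBlocks_multiply]
  have hANAeg : AN * Aeg = fromBlocks (X * G) (X * H) (Y * G) (Y * H) := by
    simp [hAN, hAeg, fromBlocks_multiply]
  have hAegAN : Aeg * AN = fromBlocks (G * G) 0 0 0 := by
    simp [hAN, hAeg, fromBlocks_multiply, hGXHY]
  have hAegAeg : Aeg * Aeg = fromBlocks (G * G) (G * H) 0 0 := by
    simp [hAeg, fromBlocks_multiply]
  refine List.tfae_of_forall (L = 0) _ ?_
  simp only [List.forall_mem_cons, List.not_mem_nil, false_imp_iff, implies_true, and_true]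
  refine ⟨⟨fun h => ?_, fun hL => ?_⟩, ⟨fun h => ?_, fun hL => ?_⟩, ⟨fun h => ?_, fun hL => ?_⟩,
    ⟨fun h => ?_, fun hL => by rw [hAN_eq hL]⟩, ⟨fun h => ?_, fun hL => by rw [hAN_eq hL]⟩,
    ⟨fun h => ?_, fun hL => by rw [hAN_eq hL]⟩, ⟨fun h => ?_, fun hL => by rw [hAN_eq hL]⟩,
    ⟨fun h => ?_, fun hL => by rw [hAN_eq hL]⟩, ⟨fun h => ?_, fun hL => by rw [hAN_eq hL]⟩,
    ⟨fun h => ?_, fun hL => by rw [hAN_eq hL]⟩, ⟨fun h => ?_, fun hL => by rw [hAN_eq hL]⟩,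
    ⟨fun h => ?_, fun hL => by rw [hAN_eq hL]⟩, ⟨fun h => ?_, fun hL => by rw [hAN_eq hL]⟩,
    ⟨fun h => ?_, fun hL => by rw [hAN_eq hL]⟩, ⟨fun h => ?_, fun hL => by rw [hAN_eq hL]⟩⟩
  · rw [hAAN, hANA, fromBlocks_inj] at h
    exact (mul_eq_zero_iff_of_isUnit_left hK.star).mp h.2.1.symm
  · rw [hAAN, hANA_one hL]
  · rw [Matrix.mul_assoc Aᴴ, hAAN, hAH, fromBlocks_multiply, fromBlocks_multiply,
      fromBlocks_inj] at h
    have h' := h.2.2.1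
    simp only [Matrix.zero_mul, Matrix.mul_one, Matrix.mul_zero, add_zero] at h'
    exact conjTranspose_eq_zero.mp ((mul_eq_zero_iff_of_isUnit_right hS₁.star).mp h'.symm)
  · rw [Matrix.mul_assoc Aᴴ, hAAN, hAH, fromBlocks_multiply, fromBlocks_multiply, hL, hM0 hL]
    simp
  · rw [Matrix.mul_assoc Aᴴ, hAHW, hANAW] at h
    set W := fromBlocks K L M N with hW
    set D : Matrix (m ⊕ n) (m ⊕ n) R := fromBlocks S₁ᴴ 0 0 S₂ᴴ with hD
    set E : Matrix (m ⊕ n) (m ⊕ n) R := fromBlocks 1 0 0 0 with hE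
    have h' : D * Wᴴ * E = E * D * Wᴴ := by
      calc D * Wᴴ * E = W * Wᴴ * D * Wᴴ * E * (W * Wᴴ) := by
            rw [hW₁, Matrix.one_mul, Matrix.mul_one]
        _ = W * (Wᴴ * D * (Wᴴ * E * W)) * Wᴴ := by simp only [Matrix.mul_assoc]
        _ = W * (Wᴴ * E * W * (Wᴴ * D)) * Wᴴ := by rw [h]
        _ = W * Wᴴ * E * (W * Wᴴ) * D * Wᴴ := by simp only [Matrix.mul_assoc]
        _ = E * D * Wᴴ := by rw [hW₁, Matrix.one_mul, Matrix.mul_one]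
    rw [hD, hE, hW, fromBlocks_conjTranspose] at h'
    simp only [fromBlocks_multiply, Matrix.zero_mul, Matrix.mul_zero, add_zero, zero_add,
      Matrix.mul_one, Matrix.one_mul, fromBlocks_inj] at h'
    have hM : M = 0 := conjTranspose_eq_zero.mp
      ((mul_eq_zero_iff_of_isUnit_left hS₁.star).mp h'.2.1.symm)
    rw [hM, conjTranspose_zero, Matrix.zero_mul, add_zero] at hKL'
    exact (mul_eq_zero_iff_of_isUnit_left hK.star).mp hKL'
  · rw [Matrix.mul_assoc Aᴴ, hANA_one hL, hAH, fromBlocks_multiply, fromBlocks_multiply, hL, hM0 hL]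
    simp
  · rw [hANAN, hANAeg, fromBlocks_inj] at h
    exact hH0.mp (cX h.2.1.symm)
  · rw [hANAN, hAegAN, fromBlocks_inj] at h
    exact hY0.mp (cX' h.2.2.1)
  · rw [hANAN, hAegAeg, fromBlocks_inj] at h
    exact hY0.mp (cX' h.2.2.1)
  · rw [hAegAN, hAegAeg, fromBlocks_inj] at h
    exact hH0.mp (cG h.2.1.symm)
  · rw [hANAeg, hAegAeg, fromBlocks_inj] at h
    exact hY0.mp (cG' h.2.2.1)
  · rw [hANAeg, hAegAN, fromBlocks_inj] at h
    exact hY0.mp (cG' h.2.2.1)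
  · rw [Matrix.mul_assoc AN Aeg, hAegAN, hANAN, hAeg, hAN] at h
    simp only [fromBlocks_multiply, Matrix.mul_zero, add_zero, fromBlocks_inj,
      Matrix.mul_assoc] at h
    exact hH0.mp (cX (cX h.2.1))
  · rw [hAegAN, hANAN, hAeg, hAN] at h
    simp only [fromBlocks_multiply, Matrix.mul_zero, add_zero, fromBlocks_inj,
      Matrix.mul_assoc] at h
    exact hH0.mp (cX (cX h.2.1))
  · rw [Matrix.mul_assoc AN Aeg, hAegAN, hAN] at h
    simp only [fromBlocks_multiply, Matrix.zero_mul, Matrix.mul_zero, add_zero, fromBlocks_inj,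
      ← Matrix.mul_assoc] at h
    exact hY0.mp (cG' (cG' h.2.2.1))
  · rw [Matrix.mul_assoc AN Aeg, hAegAeg, hAegAN, hAN, hAeg] at h
    simp only [fromBlocks_multiply, Matrix.zero_mul, Matrix.mul_zero, add_zero, fromBlocks_inj,
      ← Matrix.mul_assoc] at h
    exact hY0.mp (cG' (cG' h.2.2.1))
  · rw [Matrix.mul_assoc AN Aeg, hAegAeg, hAN] at h
    simp only [fromBlocks_multiply, Matrix.zero_mul, Matrix.mul_zero, add_zero, fromBlocks_inj,
      ← Matrix.mul_assoc] at h
    exact hY0.mp (cG' (cG' h.2.2.1))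
  · rw [Matrix.mul_assoc Aeg Aeg, hAegAN, hAeg] at h
    simp only [fromBlocks_multiply, Matrix.zero_mul, Matrix.mul_zero, add_zero, fromBlocks_inj,
      Matrix.mul_assoc] at h
    exact hH0.mp (cG (cG h.2.1.symm))

end Blocks

end HartwigSpindelbock

/-- Equivalent characterizations of new dual EP matrices. -/
theorem new_dual_EP_tfae
    {r s : ℕ}
    -- `Û`, a unitary matrix
    (U : Matrix (Fin r ⊕ Fin s) (Fin r ⊕ Fin s) DC)
    (hU₁ : U * Uᴴ = 1) (hU₂ : Uᴴ * U = 1)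
    -- the blocks `K, L, M, N` forming a unitary block matrix
    (K : Matrix (Fin r) (Fin r) DC) (L : Matrix (Fin r) (Fin s) DC)
    (M : Matrix (Fin s) (Fin r) DC) (N : Matrix (Fin s) (Fin s) DC)
    (hW₁ : fromBlocks K L M N * (fromBlocks K L M N)ᴴ = 1)
    (hW₂ : (fromBlocks K L M N)ᴴ * fromBlocks K L M N = 1)
    -- `Σ₁` diagonal with positive appreciable real dual diagonal entries
    (S₁ : Matrix (Fin r) (Fin r) DC) (d₁ : Fin r → DC)
    (hS₁ : S₁ = Matrix.diagonal d₁) (hd₁ : ∀ i, PosAppreciable (d₁ i))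
    -- `Σ₂` diagonal with nonnegative infinitesimal real dual diagonal entries
    (S₂ : Matrix (Fin s) (Fin s) DC) (d₂ : Fin s → DC)
    (hS₂ : S₂ = Matrix.diagonal d₂) (hd₂ : ∀ i, NonnegInfinitesimal (d₂ i))
    -- the Hartwig–Spindelböck decomposition of `Â`
    (A : Matrix (Fin r ⊕ Fin s) (Fin r ⊕ Fin s) DC)
    (hA : A = U * fromBlocks (S₁ * K) (S₁ * L) (S₂ * M) (S₂ * N) * Uᴴ)
    -- `Â^N`, the NDMPI of `Â`
    (AN : Matrix (Fin r ⊕ Fin s) (Fin r ⊕ Fin s) DC)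
    (hAN : AN = U * fromBlocks (Kᴴ * S₁⁻¹) 0 (Lᴴ * S₁⁻¹) 0 * Uᴴ)
    -- `A_e`, the essential part of `Â`
    (Ae : Matrix (Fin r ⊕ Fin s) (Fin r ⊕ Fin s) DC)
    (hAe : Ae = U * fromBlocks (S₁ * K) (S₁ * L) 0 0 * Uᴴ)
    -- `K` is invertible
    (hK : IsUnit K)
    -- `A_e^#`, the group inverse of the essential part
    (Aeg : Matrix (Fin r ⊕ Fin s) (Fin r ⊕ Fin s) DC)
    (hAeg : Aeg = U * fromBlocks (K⁻¹ * S₁⁻¹) (K⁻¹ * S₁⁻¹ * K⁻¹ * L) 0 0 * Uᴴ) :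
    [A * AN = AN * A,
     A * AN * Aᴴ = Aᴴ * A * AN,
     Aᴴ * AN * A = AN * A * Aᴴ,
     AN * AN = AN * Aeg,
     AN * AN = Aeg * AN,
     AN * AN = Aeg * Aeg,
     Aeg * AN = Aeg * Aeg,
     AN * Aeg = Aeg * Aeg,
     AN * Aeg = Aeg * AN,
     AN * AN * Aeg = AN * Aeg * AN,
     AN * AN * Aeg = Aeg * AN * AN,
     AN * Aeg * AN = Aeg * AN * AN,
     AN * Aeg * Aeg = Aeg * AN * Aeg,
     AN * Aeg * Aeg = Aeg * Aeg * AN,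
     Aeg * Aeg * AN = Aeg * AN * Aeg].TFAE := by
  have hS : IsUnit S₁ := by
    rw [hS₁, isUnit_diagonal, Pi.isUnit_iff]
    exact fun i => (hd₁ i).isUnit
  subst hA hAN hAeg
  simp only [HartwigSpindelbock.conjTranspose_unitary_conj, HartwigSpindelbock.unitary_conj_mul hU₂,
    HartwigSpindelbock.unitary_conj_inj hU₂]
  exact HartwigSpindelbock.block_tfae hW₁ hW₂ hS hK rfl rfl rfl
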